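/- arXiv:2011.13442 — 2 statements merged into one kernel-verified Lean document; each statement's English description precedes it below -/
import Mathlib

section
/- Assume the RPE setup. For every 1 ≤ k ≤ K, Φ_k ∩ Λ_k = {θ̃ : |θ̃ − θ̂_k|_{2π} + |θ̃ − θ̂_{k−1}|_{2π} < π/N_k}. In particular, Φ_k ∩ Λ_k is nonempty if and only if |θ̂_k − θ̂_{k−1}|_{2π} < π/N_k, i.e., if and only if D_k := π/(2N_k) − |θ̂_k − θ̂_{k−1}|_{2π}/2 > 0. -/
open Real Metric Set

/-- The candidate set `Θ(N, φ)`: image on the circle `ℝ/2πℤ` of `{(φ + 2πn)/N : n ∈ ℤ}`. -/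
noncomputable def candSet (N : ℕ) (φ : ℝ) : Set (AddCircle (2 * π)) :=
  {x | ∃ n : ℤ, x = (((φ + 2 * π * n) / N : ℝ) : AddCircle (2 * π))}

/-- The RPE setup: strictly increasing sequence of integers `N` with `N 0 = 1`,
phases `φ`, candidate sets `Θ k = candSet (N k) (φ k)`, and RPE estimates `θhat k`,
where `θhat 0` is the unique element of `Θ 0` and `θhat k` is an element of `Θ k`
of minimal circular distance from `θhat (k-1)`. -/
structure RPE (K : ℕ) where
  N : ℕ → ℕ
  φ : ℕ → ℝ
  θhat : ℕ → AddCircle (2 * π)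
  hN0 : N 0 = 1
  hNlt : ∀ k, k < K → N k < N (k + 1)
  hmem : ∀ k, k ≤ K → θhat k ∈ candSet (N k) (φ k)
  hmin : ∀ k, 1 ≤ k → k ≤ K →
    ∀ x ∈ candSet (N k) (φ k), dist (θhat (k - 1)) (θhat k) ≤ dist (θhat (k - 1)) x

namespace RPE

variable {K : ℕ}

/-- The candidate set at generation `k`. -/
noncomputable def Θ (r : RPE K) (k : ℕ) : Set (AddCircle (2 * π)) :=
  candSet (r.N k) (r.φ k)

/-- Plausibly consistent angles at generation `k`. -/
noncomputable def Φ (r : RPE K) (k : ℕ) : Set (AddCircle (2 * π)) :=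
  {θ | dist θ (r.θhat k) < π / (r.N k : ℝ)}

/-- Consecutively consistent angles at generation `k` (`Λ 0` is the whole circle). -/
noncomputable def Λ (r : RPE K) (k : ℕ) : Set (AddCircle (2 * π)) :=
  if k = 0 then Set.univ
  else {θ | infDist θ (r.Θ k) + infDist θ (r.Θ (k - 1)) < π / (r.N k : ℝ)}

/-- Locally consistent angles at generation `k` with angular error bound `δθ`. -/
noncomputable def Δ (r : RPE K) (k : ℕ) (δθ : ℝ) : Set (AddCircle (2 * π)) :=
  {θ | infDist θ (r.Θ k) < δθ / (r.N k : ℝ)}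

end RPE

/-- Distinct candidates are at least one spacing apart. -/
theorem candSet_eq_of_dist_lt {N : ℕ} {φ : ℝ} {x y : AddCircle (2 * π)} (hN : 0 < N)
    (hx : x ∈ candSet N φ) (hy : y ∈ candSet N φ) (h : dist x y < 2 * π / N) : x = y := by
  obtain ⟨a, rfl⟩ := hx
  obtain ⟨b, rfl⟩ := hy
  have hN' : (0 : ℝ) < N := Nat.cast_pos.mpr hN
  rw [dist_eq_norm, ← AddCircle.coe_sub, AddCircle.norm_eq] at h
  rw [← sub_eq_zero, ← AddCircle.coe_sub, AddCircle.coe_eq_zero_iff]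
  generalize round ((2 * π)⁻¹ * ((φ + 2 * π * a) / N - (φ + 2 * π * b) / N)) = c at h
  have heq : (φ + 2 * π * a) / N - (φ + 2 * π * b) / N - c * (2 * π)
      = 2 * π / N * ((a - b - c * N : ℤ) : ℝ) := by
    push_cast
    field_simp
    ring
  rw [heq, abs_mul, abs_of_pos (by positivity)] at h
  have hlt : |((a - b - c * N : ℤ) : ℝ)| < 1 := by
    by_contra! hge
    exact absurd h (not_lt.mpr (le_mul_of_one_le_right (by positivity) hge))
  have hzero : a - b - c * N = 0 := Int.abs_lt_one_iff.mp (by exact_mod_cast hlt)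
  refine ⟨c, ?_⟩
  rw [hzero, Int.cast_zero, mul_zero] at heq
  rw [zsmul_eq_mul]
  linarith

/-- Every angle is within half the spacing of some candidate. -/
theorem exists_mem_candSet_dist_le {N : ℕ} (hN : 0 < N) (φ : ℝ) (z : AddCircle (2 * π)) :
    ∃ x ∈ candSet N φ, dist z x ≤ π / N := by
  obtain ⟨t, rfl⟩ := QuotientAddGroup.mk_surjective z
  have hN' : (0 : ℝ) < N := Nat.cast_pos.mpr hN
  set s : ℝ := (N * t - φ) / (2 * π) with hs
  refine ⟨_, ⟨round s, rfl⟩, ?_⟩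
  calc dist (t : AddCircle (2 * π)) (((φ + 2 * π * round s) / N : ℝ) : AddCircle (2 * π))
      ≤ |t - (φ + 2 * π * round s) / N| := by
        rw [dist_eq_norm, ← AddCircle.coe_sub]
        exact QuotientAddGroup.norm_mk_le_norm
    _ = 2 * π / N * |s - round s| := by
        have hmul : 2 * π * s = N * t - φ := by
          rw [hs]
          field_simp
        rw [← abs_of_pos (show 0 < 2 * π / N by positivity), ← abs_mul]
        congr 1
        field_simp
        linarith
    _ ≤ 2 * π / N * (1 / 2) := by
        gcongr
        exact abs_sub_round s
    _ = π / N := by ring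

/-- A candidate within half the spacing of an angle realizes the distance to the candidate set. -/
theorem infDist_candSet_eq {N : ℕ} {φ : ℝ} {x z : AddCircle (2 * π)} (hN : 0 < N)
    (hx : x ∈ candSet N φ) (h : dist z x < π / N) : infDist z (candSet N φ) = dist z x := by
  refine le_antisymm (infDist_le_dist_of_mem hx) ((le_infDist ⟨x, hx⟩).mpr fun y hy => ?_)
  by_contra! hlt
  have hxy : x = y := by
    refine candSet_eq_of_dist_lt hN hx hy ?_
    have htri := dist_triangle_left x y z
    have hsplit : 2 * π / N = π / N + π / N := by ring
    linarith
  exact absurd hlt (by rw [hxy]; exact lt_irrefl _)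

theorem RPE.N_pos {K : ℕ} (r : RPE K) {k : ℕ} (hk : k ≤ K) : 0 < r.N k := by
  cases k with
  | zero => simp [r.hN0]
  | succ k => exact (Nat.zero_le _).trans_lt (r.hNlt k hk)

theorem RPE.Φ_inter_Λ_eq {K : ℕ} (r : RPE K) {k : ℕ} (hk1 : 1 ≤ k) (hkK : k ≤ K) :
    r.Φ k ∩ r.Λ k =
      {θ : AddCircle (2 * π) |
        dist θ (r.θhat k) + dist θ (r.θhat (k - 1)) < π / (r.N k : ℝ)} := by
  have hpos := r.N_pos hkK
  have hpos' := r.N_pos ((Nat.sub_le k 1).trans hkK)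
  have hmem := r.hmem k hkK
  have hmem' := r.hmem (k - 1) ((Nat.sub_le k 1).trans hkK)
  ext θ
  simp only [RPE.Φ, RPE.Λ, RPE.Θ, if_neg (Nat.one_le_iff_ne_zero.mp hk1), mem_inter_iff,
    mem_ofPred_eq]
  constructor
  · rintro ⟨hΦ, hΛ⟩
    rw [infDist_candSet_eq hpos hmem hΦ, ← lt_sub_iff_add_lt', infDist_lt_iff ⟨_, hmem'⟩] at hΛ
    obtain ⟨y, hy, hθy⟩ := hΛ
    have hnear : dist (r.θhat (k - 1)) (r.θhat k) ≤ π / r.N k := by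
      obtain ⟨x, hx, hle⟩ := exists_mem_candSet_dist_le hpos (r.φ k) (r.θhat (k - 1))
      exact (r.hmin k hk1 hkK x hx).trans hle
    have hle : (r.N (k - 1) : ℝ) ≤ r.N k := by
      have hlt := r.hNlt (k - 1) (by omega)
      rw [Nat.sub_add_cancel hk1] at hlt
      exact_mod_cast hlt.le
    have hspacing : 2 * π / r.N k ≤ 2 * π / r.N (k - 1) := by
      have : (0 : ℝ) < r.N (k - 1) := Nat.cast_pos.mpr hpos'
      gcongr
    have hy_eq : y = r.θhat (k - 1) := by
      refine candSet_eq_of_dist_lt hpos' hy hmem' (lt_of_lt_of_le ?_ hspacing)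
      have htri := dist_triangle_left y (r.θhat k) θ
      have htri' := dist_triangle_right y (r.θhat (k - 1)) (r.θhat k)
      have hsplit : 2 * π / r.N k = π / r.N k + π / r.N k := by ring
      linarith
    rw [hy_eq] at hθy
    linarith
  · intro h
    have hle := infDist_le_dist_of_mem (x := θ) hmem
    have hle' := infDist_le_dist_of_mem (x := θ) hmem'
    have hnonneg := dist_nonneg (x := θ) (y := r.θhat (k - 1))
    exact ⟨by linarith, by linarith⟩

/-- In the RPE setup, for every `1 ≤ k ≤ K`,
`Φ k ∩ Λ k = {θ : |θ - θhat k|_{2π} + |θ - θhat (k-1)|_{2π} < π / N k}`.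
In particular, `Φ k ∩ Λ k` is nonempty iff `|θhat k - θhat (k-1)|_{2π} < π / N k`,
i.e. iff `D k := π/(2 N k) - |θhat k - θhat (k-1)|_{2π}/2 > 0`. -/
theorem stmt7 (K : ℕ) (r : RPE K) (k : ℕ) (hk1 : 1 ≤ k) (hkK : k ≤ K) :
    (r.Φ k ∩ r.Λ k =
      {θ : AddCircle (2 * π) |
        dist θ (r.θhat k) + dist θ (r.θhat (k - 1)) < π / (r.N k : ℝ)}) ∧
    ((r.Φ k ∩ r.Λ k).Nonempty ↔ dist (r.θhat k) (r.θhat (k - 1)) < π / (r.N k : ℝ)) ∧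
    ((r.Φ k ∩ r.Λ k).Nonempty ↔
      0 < π / (2 * (r.N k : ℝ)) - dist (r.θhat k) (r.θhat (k - 1)) / 2) := by
  have hnonempty : (r.Φ k ∩ r.Λ k).Nonempty ↔
      dist (r.θhat k) (r.θhat (k - 1)) < π / (r.N k : ℝ) := by
    rw [r.Φ_inter_Λ_eq hk1 hkK]
    constructor
    · rintro ⟨θ, hθ⟩
      exact (dist_triangle_left _ _ θ).trans_lt hθ
    · exact fun h => ⟨r.θhat k, by simpa using h⟩
  refine ⟨r.Φ_inter_Λ_eq hk1 hkK, hnonempty, hnonempty.trans ?_⟩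
  have hhalf : π / (2 * (r.N k : ℝ)) = π / r.N k / 2 := by ring
  rw [hhalf]
  constructor <;> intro h <;> linarith
end

section
/- (Interval form of local consistency.) Assume the RPE setup, and let δθ_0, …, δθ_K > 0 satisfy δθ_k/N_k + δθ_{k−1}/N_{k−1} ≤ π/N_k for every 1 ≤ k ≤ K. Then for every k ≤ K, ∩_{k′≤k} Δ_{k′}[δθ_{k′}] = ∩_{k′≤k} {θ̃ : |θ̃ − θ̂_{k′}|_{2π} < δθ_{k′}/N_{k′}}; i.e., on the intersection, the distance to the candidate set Θ_{k′} is realized by the RPE-chosen angle θ̂_{k′}. -/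
open Real Metric Set

/-- Distinct points of a candidate set are at circular distance at least `2π / N`. -/
theorem eq_of_mem_candSet_of_dist_lt {N : ℕ} (hN : 0 < N) {φ : ℝ} {x y : AddCircle (2 * π)}
    (hx : x ∈ candSet N φ) (hy : y ∈ candSet N φ) (hxy : dist x y < 2 * π / N) : x = y := by
  obtain ⟨m, rfl⟩ := hx
  obtain ⟨n, rfl⟩ := hy
  have hN' : (0 : ℝ) < N := by exact_mod_cast hN
  rw [dist_eq_norm, ← AddCircle.coe_sub, AddCircle.norm_eq] at hxy
  set j : ℤ := round ((2 * π)⁻¹ * ((φ + 2 * π * m) / N - (φ + 2 * π * n) / N))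
  have hdiff : (φ + 2 * π * m) / N - (φ + 2 * π * n) / N - j * (2 * π) =
      2 * π / N * ((m - n - N * j : ℤ) : ℝ) := by
    push_cast
    field_simp
    ring
  have hpos : 0 < 2 * π / N := by positivity
  rw [hdiff, abs_mul, abs_of_pos hpos, mul_lt_iff_lt_one_right hpos] at hxy
  have hzero : m - n - N * j = 0 := Int.abs_lt_one_iff.mp (by exact_mod_cast hxy)
  rw [hzero, Int.cast_zero, mul_zero] at hdiff
  rw [← sub_eq_zero, ← AddCircle.coe_sub, AddCircle.coe_eq_zero_iff]
  exact ⟨j, by rw [zsmul_eq_mul]; linarith⟩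

namespace RPE

theorem N_pos_s9 {K : ℕ} (r : RPE K) {k : ℕ} (hk : k ≤ K) : 0 < r.N k := by
  cases k with
  | zero => simp [r.hN0]
  | succ k => exact (Nat.zero_le _).trans_lt (r.hNlt k hk)

theorem eq_θhat_zero {K : ℕ} (r : RPE K) {x : AddCircle (2 * π)} (hx : x ∈ r.Θ 0) :
    x = r.θhat 0 := by
  have h (y) (hy : y ∈ r.Θ 0) : y = (r.φ 0 : AddCircle (2 * π)) := by
    obtain ⟨n, rfl⟩ := hy
    rw [← sub_eq_zero, ← AddCircle.coe_sub, AddCircle.coe_eq_zero_iff]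
    exact ⟨n, by simp [r.hN0, mul_comm]⟩
  rw [h x hx, h _ (r.hmem 0 K.zero_le)]

/-- A candidate closer than `π / N` to the previous estimate is the next estimate. -/
theorem eq_θhat_succ {K : ℕ} (r : RPE K) {k : ℕ} (hk : k + 1 ≤ K) {x : AddCircle (2 * π)}
    (hx : x ∈ r.Θ (k + 1)) (hdist : dist (r.θhat k) x < π / r.N (k + 1)) :
    x = r.θhat (k + 1) := by
  have hmin : dist (r.θhat k) (r.θhat (k + 1)) ≤ dist (r.θhat k) x :=
    r.hmin (k + 1) (Nat.le_add_left 1 k) hk x hx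
  refine eq_of_mem_candSet_of_dist_lt (r.N_pos_s9 hk) hx (r.hmem _ hk) ?_
  have htri := dist_triangle_left x (r.θhat (k + 1)) (r.θhat k)
  rw [mul_div_assoc]
  linarith

end RPE

/-- Interval form of local consistency.  In the RPE setup, if `δθ 0, …, δθ K > 0`
satisfy `δθ k / N k + δθ (k-1) / N (k-1) ≤ π / N k` for every `1 ≤ k ≤ K`, then for
every `k ≤ K`,
`⋂_{k' ≤ k} Δ k' [δθ k'] = ⋂_{k' ≤ k} {θ : |θ - θhat k'|_{2π} < δθ k' / N k'}`;
i.e. on the intersection the distance to `Θ k'` is realized by `θhat k'`. -/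
theorem stmt9 (K : ℕ) (r : RPE K) (δθ : ℕ → ℝ) (hpos : ∀ k ≤ K, 0 < δθ k)
    (hcond : ∀ k, 1 ≤ k → k ≤ K →
      δθ k / (r.N k : ℝ) + δθ (k - 1) / (r.N (k - 1) : ℝ) ≤ π / (r.N k : ℝ))
    (k : ℕ) (hk : k ≤ K) :
    (⋂ k' ∈ Set.Iic k, r.Δ k' (δθ k')) =
      ⋂ k' ∈ Set.Iic k,
        {θ : AddCircle (2 * π) | dist θ (r.θhat k') < δθ k' / (r.N k' : ℝ)} := by
  have hne (j : ℕ) (hj : j ≤ K) : (r.Θ j).Nonempty := ⟨_, r.hmem j hj⟩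
  ext θ
  simp only [mem_iInter, mem_Iic, RPE.Δ, mem_ofPred_eq]
  refine ⟨fun h j hj ↦ ?_, fun h j hj ↦
    (infDist_le_dist_of_mem (r.hmem j (hj.trans hk))).trans_lt (h j hj)⟩
  obtain ⟨x, hx, hθx⟩ := (infDist_lt_iff (hne j (hj.trans hk))).mp (h j hj)
  induction j generalizing x with
  | zero => rwa [← r.eq_θhat_zero hx]
  | succ j ih =>
    have hj' : j ≤ k := (Nat.le_succ j).trans hj
    obtain ⟨y, hy, hθy⟩ := (infDist_lt_iff (hne j (hj'.trans hk))).mp (h j hj')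
    have hprev := ih hj' y hy hθy
    have hc := hcond (j + 1) (Nat.le_add_left 1 j) (hj.trans hk)
    rw [Nat.add_sub_cancel] at hc
    have htri := dist_triangle_left (r.θhat j) x θ
    rwa [← r.eq_θhat_succ (hj.trans hk) hx (by linarith)]
end
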